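/- arXiv:1904.01678 — 2 statements merged into one kernel-verified Lean document; each statement's English description precedes it below -/
import Mathlib

section
/- Let v be a weight on ℝⁿ and Y : 𝒬 → (0,∞) a functional on the family 𝒬 of all axis-parallel cubes in ℝⁿ. Then there is a dimensional constant C_n (independent of v and Y) such that for every b ∈ BMO, ‖b‖_{BMO_{v,Y}} ≤ C_n [v]_{A∞,Y} ‖b‖_{BMO}; that is, sup_Q (1/Y(Q)) ∫_Q |b(x) − b_Q| v(x) dx ≤ C_n [v]_{A∞,Y} ‖b‖_{BMO}. -/
open MeasureTheory ENNReal Set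

noncomputable section

/-- The axis-parallel cube in `ℝⁿ` with lower corner `a` and side length `h`. -/
def Cube {n : ℕ} (a : Fin n → ℝ) (h : ℝ) : Set (Fin n → ℝ) :=
  Set.univ.pi fun i => Set.Icc (a i) (a i + h)

/-- The concentric double `2Q` of the cube with lower corner `a` and side length `h`. -/
def Cube2 {n : ℕ} (a : Fin n → ℝ) (h : ℝ) : Set (Fin n → ℝ) :=
  Cube (fun i => a i - h / 2) (2 * h)

/-- The average `f_Q` of `f` over the cube with lower corner `a` and side length `h`. -/
def cubeAvg {n : ℕ} (a : Fin n → ℝ) (h : ℝ) (f : (Fin n → ℝ) → ℝ) : ℝ :=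
  ⨍ x in Cube a h, f x

/-- The (uncentered) Hardy–Littlewood maximal function over axis-parallel cubes. -/
def maxFn {n : ℕ} (f : (Fin n → ℝ) → ℝ) (x : Fin n → ℝ) : ℝ≥0∞ :=
  ⨆ (a : Fin n → ℝ) (h : ℝ) (_ : 0 < h) (_ : x ∈ Cube a h),
    (∫⁻ y in Cube a h, ENNReal.ofReal |f y|) / volume (Cube a h)

/-- The BMO seminorm `sup_Q (1/|Q|) ∫_Q |f - f_Q|`, valued in `ℝ≥0∞`. -/
def bmoNorm {n : ℕ} (f : (Fin n → ℝ) → ℝ) : ℝ≥0∞ :=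
  ⨆ (a : Fin n → ℝ) (h : ℝ) (_ : 0 < h),
    (∫⁻ x in Cube a h, ENNReal.ofReal |f x - cubeAvg a h f|) / volume (Cube a h)

/-- The generalized weighted BMO norm `‖f‖_{BMO_{v,Y}} = sup_Q (1/Y(Q)) ∫_Q |f - f_Q| v`. -/
def bmoVY {n : ℕ} (v : (Fin n → ℝ) → ℝ) (Y : (Fin n → ℝ) → ℝ → ℝ≥0∞)
    (f : (Fin n → ℝ) → ℝ) : ℝ≥0∞ :=
  ⨆ (a : Fin n → ℝ) (h : ℝ) (_ : 0 < h),
    (∫⁻ x in Cube a h, ENNReal.ofReal (|f x - cubeAvg a h f| * v x)) / Y a h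

/-- `w(Q) = ∫_Q w` for a cube `Q`. -/
def wInt {n : ℕ} (w : (Fin n → ℝ) → ℝ) (a : Fin n → ℝ) (h : ℝ) : ℝ≥0∞ :=
  ∫⁻ x in Cube a h, ENNReal.ofReal (w x)

/-- `w(2Q) = ∫_{2Q} w` for a cube `Q`. -/
def wInt2 {n : ℕ} (w : (Fin n → ℝ) → ℝ) (a : Fin n → ℝ) (h : ℝ) : ℝ≥0∞ :=
  ∫⁻ x in Cube2 a h, ENNReal.ofReal (w x)

/-- The generalized Fujii–Wilson constant `[v]_{A_{∞,Y}} = sup_Q (1/Y(Q)) ∫_Q M(v χ_Q)`. -/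
def fwY {n : ℕ} (v : (Fin n → ℝ) → ℝ) (Y : (Fin n → ℝ) → ℝ → ℝ≥0∞) : ℝ≥0∞ :=
  ⨆ (a : Fin n → ℝ) (h : ℝ) (_ : 0 < h),
    (∫⁻ x in Cube a h, maxFn ((Cube a h).indicator v) x) / Y a h

/-- The Fujii–Wilson `A∞` constant `[w]_{A∞} = sup_Q (1/w(Q)) ∫_Q M(w χ_Q)`. -/
def fwConst {n : ℕ} (w : (Fin n → ℝ) → ℝ) : ℝ≥0∞ :=
  ⨆ (a : Fin n → ℝ) (h : ℝ) (_ : 0 < h),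
    (∫⁻ x in Cube a h, maxFn ((Cube a h).indicator w) x) / wInt w a h

/-- The weak Fujii–Wilson constant `[w]^{weak}_{A∞} = sup_Q (1/w(2Q)) ∫_Q M(w χ_Q)`. -/
def fwWeak {n : ℕ} (w : (Fin n → ℝ) → ℝ) : ℝ≥0∞ :=
  ⨆ (a : Fin n → ℝ) (h : ℝ) (_ : 0 < h),
    (∫⁻ x in Cube a h, maxFn ((Cube a h).indicator w) x) / wInt2 w a h

/-- The `C_p` normalizing functional `Y(Q) = ∫_{ℝⁿ} M(χ_Q)^p w`. -/
def cpY {n : ℕ} (p : ℝ) (w : (Fin n → ℝ) → ℝ) (a : Fin n → ℝ) (h : ℝ) : ℝ≥0∞ :=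
  ∫⁻ x, (maxFn ((Cube a h).indicator fun _ => (1 : ℝ)) x) ^ p * ENNReal.ofReal (w x)

/-- The `C_p` Fujii–Wilson-type constant `[w]_{C_p}`. -/
def cpConst {n : ℕ} (p : ℝ) (w : (Fin n → ℝ) → ℝ) : ℝ≥0∞ :=
  ⨆ (a : Fin n → ℝ) (h : ℝ) (_ : 0 < h),
    (∫⁻ x in Cube a h, maxFn ((Cube a h).indicator w) x) / cpY p w a h

/-- The `A_p` constant `[w]_{A_p}` for `1 < p < ∞`. -/
def apConst {n : ℕ} (p : ℝ) (w : (Fin n → ℝ) → ℝ) : ℝ≥0∞ :=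
  ⨆ (a : Fin n → ℝ) (h : ℝ) (_ : 0 < h),
    (wInt w a h / volume (Cube a h)) *
      ((∫⁻ x in Cube a h, ENNReal.ofReal (w x) ^ (1 - p / (p - 1))) / volume (Cube a h)) ^ (p - 1)

/-- A weight: a nonnegative locally integrable function on `ℝⁿ`. -/
def IsWeight {n : ℕ} (v : (Fin n → ℝ) → ℝ) : Prop :=
  (∀ x, 0 ≤ v x) ∧ LocallyIntegrable v volume

/-- A cube functional `Y : 𝒬 → (0,∞)`: positive finite values on cubes. -/
def IsCubeFunctional {n : ℕ} (Y : (Fin n → ℝ) → ℝ → ℝ≥0∞) : Prop :=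
  ∀ (a : Fin n → ℝ) (h : ℝ), 0 < h → 0 < Y a h ∧ Y a h < ⊤

/-- Membership in the class `𝒴_q` with constant `β`: for every cube `Q`, every `L ≥ 1`
and every `L`-small family of pairwise non-overlapping subcubes of `Q`,
`∑_{P ∈ Λ} Y(P) ≤ β Y(Q) L^{-1/q}`. -/
def MemY {n : ℕ} (q β : ℝ) (Y : (Fin n → ℝ) → ℝ → ℝ≥0∞) : Prop :=
  ∀ (a : Fin n → ℝ) (h : ℝ), 0 < h → ∀ L : ℝ, 1 ≤ L →
    ∀ Λ : Set ((Fin n → ℝ) × ℝ),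
      (∀ p ∈ Λ, 0 < p.2 ∧ Cube p.1 p.2 ⊆ Cube a h) →
      (Λ.Pairwise fun p r => Disjoint (interior (Cube p.1 p.2)) (interior (Cube r.1 r.2))) →
      (∑' p : Λ, volume (Cube p.1.1 p.1.2)) ≤ volume (Cube a h) / ENNReal.ofReal L →
      (∑' p : Λ, Y p.1.1 p.1.2) ≤ ENNReal.ofReal β * Y a h * ENNReal.ofReal (L ^ (-1 / q))

/-- The Luxemburg norm in the Orlicz space `exp L^β` with respect to the measure `μ`. -/
def expLuxNorm {X : Type*} [MeasurableSpace X] (μ : Measure X) (β : ℝ) (g : X → ℝ) : ℝ≥0∞ :=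
  ⨅ (lam : ℝ) (_ : 0 < lam)
    (_ : ∫⁻ x, ENNReal.ofReal (Real.exp ((|g x| / lam) ^ β) - 1) ∂μ ≤ 1), ENNReal.ofReal lam

/-- The weighted measure `w dx` restricted to a set `Q`. -/
def wMeasureOn {n : ℕ} (w : (Fin n → ℝ) → ℝ) (Q : Set (Fin n → ℝ)) : Measure (Fin n → ℝ) :=
  (volume.restrict Q).withDensity fun x => ENNReal.ofReal (w x)

/-- The dyadic grid `𝒟(Q)` relative to the cube with lower corner `a₀` and side `h₀`:
parameters of all dyadic subcubes of `Q`. -/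
def dyadicOf {n : ℕ} (a₀ : Fin n → ℝ) (h₀ : ℝ) : Set ((Fin n → ℝ) × ℝ) :=
  {p | ∃ (k : ℕ) (m : Fin n → ℕ), (∀ i, m i < 2 ^ k) ∧
    p.2 = h₀ / 2 ^ k ∧ p.1 = fun i => a₀ i + (m i : ℝ) * (h₀ / 2 ^ k)}

/-- The functional `w_r(Q) = |Q| ((1/|Q|) ∫_Q w^r)^{1/r}`. -/
def wrY {n : ℕ} (w : (Fin n → ℝ) → ℝ) (r : ℝ) (a : Fin n → ℝ) (h : ℝ) : ℝ≥0∞ :=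
  volume (Cube a h) *
    ((∫⁻ x in Cube a h, ENNReal.ofReal (w x) ^ r) / volume (Cube a h)) ^ (1 / r)

/-- The half-open version of `Cube a h`. -/
def HalfOpenCube {n : ℕ} (a : Fin n → ℝ) (h : ℝ) : Set (Fin n → ℝ) :=
  Set.univ.pi fun i => Set.Ico (a i) (a i + h)

/-- The lower corner of the dyadic child, with index `ε`, of the cube with lower corner `a` and
side length `h`. -/
def childCorner {n : ℕ} (a : Fin n → ℝ) (h : ℝ) (ε : Fin n → Fin 2) : Fin n → ℝ :=
  fun i => a i + (ε i : ℕ) * (h / 2)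

/-- The lower corner of the half-open cube containing `x` in the grid of side length `h / 2 ^ N`
based at `a`. -/
def gridCorner {n : ℕ} (N : ℕ) (a : Fin n → ℝ) (h : ℝ) (x : Fin n → ℝ) : Fin n → ℝ :=
  fun i => a i + ⌊(x i - a i) * 2 ^ N / h⌋ * (h / 2 ^ N)

/-- The average of `b` over the cube of side length `h / 2 ^ N` containing `x` in the grid based
at `a`. -/
def dyadicAvg {n : ℕ} (b : (Fin n → ℝ) → ℝ) (N : ℕ) (a : Fin n → ℝ) (h : ℝ)
    (x : Fin n → ℝ) : ℝ :=
  cubeAvg (gridCorner N a h x) (h / 2 ^ N) b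

section Cubes

variable {n : ℕ} {a : Fin n → ℝ} {h : ℝ}

lemma measurableSet_halfOpenCube : MeasurableSet (HalfOpenCube a h) :=
  MeasurableSet.univ_pi fun _ => measurableSet_Ico

lemma halfOpenCube_subset_cube : HalfOpenCube a h ⊆ Cube a h :=
  Set.pi_mono fun _ _ => Ico_subset_Icc_self

lemma cube_eq_Icc : Cube a h = Icc a (fun i => a i + h) := by
  rw [Cube, Set.pi_univ_Icc]

lemma restrict_cube : (volume.restrict (Cube a h) : Measure (Fin n → ℝ)) =
    volume.restrict (HalfOpenCube a h) := by
  refine Measure.restrict_congr_set ?_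
  rw [cube_eq_Icc]
  exact Measure.univ_pi_Ico_ae_eq_Icc.symm

lemma volume_halfOpenCube : volume (HalfOpenCube a h) = ENNReal.ofReal h ^ n := by
  simp [HalfOpenCube, Real.volume_pi_Ico]

lemma volume_cube : volume (Cube a h) = ENNReal.ofReal h ^ n := by
  have := congrArg (fun μ : Measure (Fin n → ℝ) => μ univ) (restrict_cube (a := a) (h := h))
  simpa [volume_halfOpenCube] using this

lemma volume_halfOpenCube_ne_zero (hh : 0 < h) : volume (HalfOpenCube a h) ≠ 0 := by
  rw [volume_halfOpenCube]
  exact pow_ne_zero _ (by simpa using hh)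

lemma volume_halfOpenCube_ne_top : volume (HalfOpenCube a h) ≠ ⊤ := by
  rw [volume_halfOpenCube]
  exact ENNReal.pow_ne_top ENNReal.ofReal_ne_top

lemma volume_child (c : Fin n → ℝ) :
    2 ^ n * volume (HalfOpenCube c (h / 2)) = volume (HalfOpenCube a h) := by
  rw [volume_halfOpenCube, volume_halfOpenCube, ← mul_pow]
  congr 1
  rw [← ENNReal.ofReal_ofNat, ← ENNReal.ofReal_mul (by norm_num)]
  congr 1
  ring

lemma iUnion_child :
    ⋃ ε : Fin n → Fin 2, HalfOpenCube (childCorner a h ε) (h / 2) = HalfOpenCube a h := by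
  ext x
  simp only [HalfOpenCube, childCorner, mem_iUnion, mem_univ_pi, mem_Ico]
  constructor
  · rintro ⟨ε, hε⟩ i
    have h2 : ε i = 0 ∨ ε i = 1 := by omega
    have := hε i
    rcases h2 with h2 | h2 <;> simp only [h2] at this <;> norm_num at this <;>
      constructor <;> linarith
  · intro hx
    refine ⟨fun i => if x i < a i + h / 2 then 0 else 1, fun i => ?_⟩
    have := hx i
    dsimp only
    split_ifs with h1 <;> norm_num <;> constructor <;> linarith

lemma child_subset (ε : Fin n → Fin 2) :
    HalfOpenCube (childCorner a h ε) (h / 2) ⊆ HalfOpenCube a h := by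
  rw [← iUnion_child (a := a)]
  exact subset_iUnion (fun ε => HalfOpenCube (childCorner a h ε) (h / 2)) ε

lemma pairwise_disjoint_child :
    Pairwise (Function.onFun Disjoint
      fun ε : Fin n → Fin 2 => HalfOpenCube (childCorner a h ε) (h / 2)) := by
  intro ε δ hne
  obtain ⟨i, hi⟩ := Function.ne_iff.1 hne
  refine Set.disjoint_left.2 fun x hx hy => ?_
  have h1 := hx i trivial
  have h2 := hy i trivial
  simp only [childCorner, mem_Ico] at h1 h2
  have hε : ε i = 0 ∨ ε i = 1 := by omega
  have hδ : δ i = 0 ∨ δ i = 1 := by omega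
  rcases hε with hε | hε <;> rcases hδ with hδ | hδ <;> simp only [hε, hδ] at h1 h2 hi <;>
    norm_num at h1 h2 hi <;> linarith

lemma lintegral_eq_sum_child (f : (Fin n → ℝ) → ℝ≥0∞) :
    ∫⁻ x in HalfOpenCube a h, f x =
      ∑ ε : Fin n → Fin 2, ∫⁻ x in HalfOpenCube (childCorner a h ε) (h / 2), f x := by
  rw [← iUnion_child (a := a), lintegral_iUnion (fun _ => measurableSet_halfOpenCube)
    pairwise_disjoint_child, tsum_fintype]

lemma volume_eq_sum_child :
    volume (HalfOpenCube a h) =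
      ∑ ε : Fin n → Fin 2, volume (HalfOpenCube (childCorner a h ε) (h / 2)) := by
  simpa using lintegral_eq_sum_child (a := a) (h := h) fun _ => 1

lemma dyadicAvg_succ (b : (Fin n → ℝ) → ℝ) (N : ℕ) (hh : 0 < h) (ε : Fin n → Fin 2) :
    dyadicAvg b (N + 1) a h = dyadicAvg b N (childCorner a h ε) (h / 2) := by
  funext x
  have h1 : h / 2 ^ (N + 1) = h / 2 / 2 ^ N := by rw [pow_succ]; field_simp
  unfold dyadicAvg
  rw [h1]
  congr 1
  funext i
  have h2 : (x i - a i) * 2 ^ (N + 1) / h =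
      (x i - childCorner a h ε i) * 2 ^ N / (h / 2) + ((2 ^ N * (ε i : ℕ) : ℕ) : ℝ) := by
    simp only [childCorner]
    push_cast
    field_simp
    ring
  simp only [gridCorner, h1]
  rw [h2, Int.floor_add_natCast]
  simp only [childCorner]
  push_cast
  field_simp
  ring

lemma dyadicAvg_zero (b : (Fin n → ℝ) → ℝ) {x : Fin n → ℝ} (hh : 0 < h)
    (hx : x ∈ HalfOpenCube a h) : dyadicAvg b 0 a h x = cubeAvg a h b := by
  unfold dyadicAvg
  simp only [pow_zero, div_one]
  congr 1
  funext i
  have h1 := hx i trivial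
  have : ⌊(x i - a i) / h⌋ = 0 := by
    rw [Int.floor_eq_zero_iff]
    constructor
    · have := h1.1
      have : 0 ≤ x i - a i := by linarith
      positivity
    · rw [div_lt_one hh]
      linarith [h1.2]
  simp [gridCorner, this]

lemma measurable_dyadicAvg (b : (Fin n → ℝ) → ℝ) (N : ℕ) (a : Fin n → ℝ) (h : ℝ) :
    Measurable (dyadicAvg b N a h) := by
  have h1 : Measurable fun (x : Fin n → ℝ) (i : Fin n) => ⌊(x i - a i) * 2 ^ N / h⌋ := by
    fun_prop
  exact (measurable_of_countable (fun m : Fin n → ℤ =>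
    cubeAvg (fun i => a i + m i * (h / 2 ^ N)) (h / 2 ^ N) b)).comp h1

lemma cube_eq_closedBall (hh : 0 < h) :
    Cube a h = Metric.closedBall (fun i => a i + h / 2) (h / 2) := by
  rw [closedBall_pi _ (by positivity)]
  unfold Cube
  congr 1
  funext i
  rw [Real.closedBall_eq_Icc]
  congr 1 <;> ring

lemma mem_cube_gridCorner (N : ℕ) (hh : 0 < h) (x : Fin n → ℝ) :
    x ∈ Cube (gridCorner N a h x) (h / 2 ^ N) := by
  intro i _
  have h1 := Int.floor_le ((x i - a i) * 2 ^ N / h)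
  have h2 := Int.lt_floor_add_one ((x i - a i) * 2 ^ N / h)
  have hp : 0 < h / 2 ^ N := by positivity
  have h3 : (x i - a i) * 2 ^ N / h * (h / 2 ^ N) = x i - a i := by field_simp
  have h4 := mul_le_mul_of_nonneg_right h1 hp.le
  have h5 := mul_lt_mul_of_pos_right h2 hp
  simp only [gridCorner, mem_Icc]
  constructor <;> nlinarith

lemma ae_tendsto_dyadicAvg {b : (Fin n → ℝ) → ℝ} (hb : LocallyIntegrable b volume) (hh : 0 < h) :
    ∀ᵐ x, Filter.Tendsto (fun N => dyadicAvg b N a h x) Filter.atTop (nhds (b x)) := by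
  filter_upwards [IsUnifLocDoublingMeasure.ae_tendsto_average volume hb 1] with x hx
  have hδ : Filter.Tendsto (fun N : ℕ => h / 2 ^ N / 2) Filter.atTop (nhdsWithin 0 (Ioi 0)) := by
    refine tendsto_nhdsWithin_iff.2 ⟨?_, Filter.Eventually.of_forall fun N => ?_⟩
    · have := (tendsto_pow_atTop_nhds_zero_of_lt_one (r := (1 / 2 : ℝ)) (by norm_num)
        (by norm_num)).const_mul (h / 2)
      rw [mul_zero] at this
      refine this.congr fun N => ?_
      rw [one_div, inv_pow]
      ring
    · simp only [mem_Ioi]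
      positivity
  have key := hx (fun N i => gridCorner N a h x i + h / 2 ^ N / 2) (fun N => h / 2 ^ N / 2) hδ
    (Filter.Eventually.of_forall fun N => by
      rw [one_mul, ← cube_eq_closedBall (by positivity)]
      exact mem_cube_gridCorner N hh x)
  refine key.congr fun N => ?_
  rw [dyadicAvg, cubeAvg, cube_eq_closedBall (by positivity)]

lemma integrableOn_cube_of_locallyIntegrable {f : (Fin n → ℝ) → ℝ}
    (hf : LocallyIntegrable f volume) : IntegrableOn f (Cube a h) :=
  hf.integrableOn_isCompact (isCompact_univ_pi fun _ => isCompact_Icc)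

lemma abs_cubeAvg_sub_mul_volume_le {b : (Fin n → ℝ) → ℝ} (hb : LocallyIntegrable b volume)
    (hh : 0 < h) (c : ℝ) :
    ENNReal.ofReal |cubeAvg a h b - c| * volume (HalfOpenCube a h) ≤
      ∫⁻ x in HalfOpenCube a h, ENNReal.ofReal |b x - c| := by
  have h0 := volume_halfOpenCube_ne_zero (a := a) hh
  have ht := volume_halfOpenCube_ne_top (a := a) (h := h)
  have hr : 0 < volume.real (HalfOpenCube a h) := ENNReal.toReal_pos h0 ht
  have hi : Integrable b (volume.restrict (HalfOpenCube a h)) := by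
    rw [← restrict_cube]
    exact integrableOn_cube_of_locallyIntegrable hb
  have : IsFiniteMeasure (volume.restrict (HalfOpenCube a h)) :=
    ⟨by simpa using ht.lt_top⟩
  have h1 : (cubeAvg a h b - c) * volume.real (HalfOpenCube a h) =
      ∫ x in HalfOpenCube a h, (b x - c) := by
    rw [integral_sub hi (integrable_const c), cubeAvg, restrict_cube, setAverage_eq]
    simp
    field_simp
  have h2 := enorm_integral_le_lintegral_enorm (μ := volume.restrict (HalfOpenCube a h))
    (fun x => b x - c)
  rw [← h1, enorm_mul] at h2
  simp only [Real.enorm_eq_ofReal_abs] at h2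
  rwa [abs_of_pos hr, measureReal_def, ENNReal.ofReal_toReal ht] at h2

lemma lintegral_sub_cubeAvg_le (b : (Fin n → ℝ) → ℝ) (hh : 0 < h) :
    ∫⁻ x in HalfOpenCube a h, ENNReal.ofReal |b x - cubeAvg a h b| ≤
      bmoNorm b * volume (HalfOpenCube a h) := by
  have h1 : (∫⁻ x in Cube a h, ENNReal.ofReal |b x - cubeAvg a h b|) / volume (Cube a h) ≤
      bmoNorm b := le_iSup₂_of_le a h (le_iSup_of_le hh le_rfl)
  rw [restrict_cube, volume_cube, ← volume_halfOpenCube (a := a)] at h1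
  exact (ENNReal.div_le_iff (volume_halfOpenCube_ne_zero hh) volume_halfOpenCube_ne_top).1 h1

end Cubes

section Oscillation

variable {n : ℕ} {b : (Fin n → ℝ) → ℝ} {w F : (Fin n → ℝ) → ℝ≥0∞} {S : Set (Fin n → ℝ)}

/-- If the bound with stopping parameters holds on a cube started afresh (reference value the
average of `b`, reference density the average of `w`), then it absorbs the mass of `w`. -/
lemma lintegral_add_le_of_restart {P : Set (Fin n → ℝ)} {X D B A V : ℝ≥0∞} {m Φ E : ℝ≥0∞}
    (hB : B ≠ ⊤) (hV : V ≠ ⊤) (hE : E ≠ ⊤) (hD : D = 2 * (1 + E)) (hm : m * volume P = V)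
    (hA : A ≤ B * volume P)
    (hX : X + 2 * B * D * (m * volume P) ≤ 2 * B * D * Φ + D * m * A + 2 * B * V) :
    X + 2 * B * E * V ≤ 2 * B * D * Φ := by
  have hfin : B * D * V + 2 * B * V ≠ ⊤ := by
    subst hD
    finiteness
  refine (ENNReal.add_le_add_iff_right hfin).1 ?_
  calc X + 2 * B * E * V + (B * D * V + 2 * B * V)
      = X + 2 * B * D * (m * volume P) := by rw [hm, hD]; ring
    _ ≤ 2 * B * D * Φ + D * m * A + 2 * B * V := hX
    _ ≤ 2 * B * D * Φ + D * m * (B * volume P) + 2 * B * V := by gcongr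
    _ = 2 * B * D * Φ + (B * D * (m * volume P) + 2 * B * V) := by ring
    _ = 2 * B * D * Φ + (B * D * V + 2 * B * V) := by rw [hm]

/-- The bound with stopping parameters `c` (reference value of `b`) and `m` (reference density
of `w`), for dyadic approximations of `b`. -/
lemma lintegral_dyadicAvg_sub_mul_le (hb : LocallyIntegrable b volume) (hbmo : bmoNorm b ≠ ⊤)
    (hw : AEMeasurable w volume)
    (hwfin : ∀ a h, ∫⁻ x in HalfOpenCube a h, w x ≠ ⊤)
    (hF : ∀ a h, 0 < h → HalfOpenCube a h ⊆ S → ∀ x ∈ HalfOpenCube a h,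
      (∫⁻ y in HalfOpenCube a h, w y) / volume (HalfOpenCube a h) ≤ F x)
    (N : ℕ) : ∀ (a : Fin n → ℝ) (h : ℝ) (c : ℝ) (m : ℝ≥0∞), 0 < h → HalfOpenCube a h ⊆ S →
      (∀ x ∈ HalfOpenCube a h, m ≤ F x) →
      ∫⁻ x in HalfOpenCube a h, ENNReal.ofReal |b x - c| ≤
        2 * bmoNorm b * volume (HalfOpenCube a h) →
      (∫⁻ x in HalfOpenCube a h, ENNReal.ofReal |dyadicAvg b N a h x - c| * w x) +
          2 * bmoNorm b * (2 * (1 + 2 ^ n)) * (m * volume (HalfOpenCube a h)) ≤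
        2 * bmoNorm b * (2 * (1 + 2 ^ n)) * (∫⁻ x in HalfOpenCube a h, F x) +
          2 * (1 + 2 ^ n) * m * (∫⁻ x in HalfOpenCube a h, ENNReal.ofReal |b x - c|) +
          2 * bmoNorm b * ∫⁻ x in HalfOpenCube a h, w x := by
  set B := bmoNorm b
  set D : ℝ≥0∞ := 2 * (1 + 2 ^ n) with hD
  induction N with
  | zero =>
    intro a h c m hh hS hm hA
    have h1 : ENNReal.ofReal |cubeAvg a h b - c| ≤ 2 * B := by
      have := (abs_cubeAvg_sub_mul_volume_le hb hh c).trans hA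
      exact (ENNReal.mul_le_mul_iff_left (volume_halfOpenCube_ne_zero hh)
        volume_halfOpenCube_ne_top).1 this
    have h2 : ∫⁻ x in HalfOpenCube a h, ENNReal.ofReal |dyadicAvg b 0 a h x - c| * w x ≤
        2 * B * ∫⁻ x in HalfOpenCube a h, w x := by
      rw [← lintegral_const_mul' _ _ (by finiteness)]
      refine setLIntegral_mono' measurableSet_halfOpenCube fun x hx => ?_
      rw [dyadicAvg_zero b hh hx]
      gcongr
    have h3 : m * volume (HalfOpenCube a h) ≤ ∫⁻ x in HalfOpenCube a h, F x := by
      rw [← setLIntegral_const]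
      exact setLIntegral_mono' measurableSet_halfOpenCube hm
    calc _ ≤ 2 * B * (∫⁻ x in HalfOpenCube a h, w x) +
          2 * B * D * ∫⁻ x in HalfOpenCube a h, F x := by gcongr
      _ ≤ _ := by
        rw [add_comm]
        gcongr
        exact le_self_add
  | succ N ih =>
    intro a h c m hh hS hm hA
    have hh2 : 0 < h / 2 := by positivity
    have hchild : ∀ ε : Fin n → Fin 2,
        (∫⁻ x in HalfOpenCube (childCorner a h ε) (h / 2),
            ENNReal.ofReal |dyadicAvg b (N + 1) a h x - c| * w x) +
          2 * B * D * (m * volume (HalfOpenCube (childCorner a h ε) (h / 2))) ≤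
        2 * B * D * (∫⁻ x in HalfOpenCube (childCorner a h ε) (h / 2), F x) +
          D * m * (∫⁻ x in HalfOpenCube (childCorner a h ε) (h / 2),
            ENNReal.ofReal |b x - c|) +
          2 * B * ∫⁻ x in HalfOpenCube (childCorner a h ε) (h / 2), w x := by
      intro ε
      rw [dyadicAvg_succ b N hh ε]
      set a' := childCorner a h ε
      have hsub : HalfOpenCube a' (h / 2) ⊆ HalfOpenCube a h := child_subset ε
      have hS' := hsub.trans hS
      have hv0 := volume_halfOpenCube_ne_zero (a := a') hh2
      have hvt := volume_halfOpenCube_ne_top (a := a') (h := h / 2)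
      by_cases hc : ∫⁻ x in HalfOpenCube a' (h / 2), ENNReal.ofReal |b x - c| ≤
          2 * B * volume (HalfOpenCube a' (h / 2))
      · exact ih a' (h / 2) c m hh2 hS' (fun x hx => hm x (hsub hx)) hc
      · set c' := cubeAvg a' (h / 2) b
        have hosc := lintegral_sub_cubeAvg_le (a := a') b hh2
        have hrestart := lintegral_add_le_of_restart (E := 2 ^ n) hbmo (hwfin a' (h / 2))
          (by finiteness) hD (ENNReal.div_mul_cancel hv0 hvt) hosc
          (ih a' (h / 2) c' _ hh2 hS' (hF a' (h / 2) hh2 hS')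
            (hosc.trans (by
              gcongr
              exact le_mul_of_one_le_left zero_le one_le_two)))
        have hjump : ENNReal.ofReal |c' - c| ≤ 2 * B * 2 ^ n := by
          refine (ENNReal.mul_le_mul_iff_left hv0 hvt).1 ?_
          calc _ ≤ ∫⁻ x in HalfOpenCube a' (h / 2), ENNReal.ofReal |b x - c| :=
                abs_cubeAvg_sub_mul_volume_le hb hh2 c
            _ ≤ ∫⁻ x in HalfOpenCube a h, ENNReal.ofReal |b x - c| := lintegral_mono_set hsub
            _ ≤ 2 * B * volume (HalfOpenCube a h) := hA
            _ = _ := by rw [← volume_child (a := a) a', mul_assoc (2 * B)]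
        have htri : ∫⁻ x in HalfOpenCube a' (h / 2),
              ENNReal.ofReal |dyadicAvg b N a' (h / 2) x - c| * w x ≤
            (∫⁻ x in HalfOpenCube a' (h / 2),
              ENNReal.ofReal |dyadicAvg b N a' (h / 2) x - c'| * w x) +
            2 * B * 2 ^ n * ∫⁻ x in HalfOpenCube a' (h / 2), w x := by
          rw [← lintegral_const_mul' _ _ (by finiteness),
            ← lintegral_add_right' _ (hw.restrict.const_mul _)]
          refine lintegral_mono fun x => ?_
          rw [← add_mul]
          gcongr
          refine le_trans ?_ (add_le_add_right hjump _)
          rw [← ENNReal.ofReal_add (abs_nonneg _) (abs_nonneg _)]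
          exact ENNReal.ofReal_le_ofReal (abs_sub_le _ _ _)
        have hlarge : 2 * B * D * (m * volume (HalfOpenCube a' (h / 2))) ≤
            D * m * ∫⁻ x in HalfOpenCube a' (h / 2), ENNReal.ofReal |b x - c| := by
          calc _ = D * m * (2 * B * volume (HalfOpenCube a' (h / 2))) := by ring
            _ ≤ _ := by
              gcongr
              exact (not_le.1 hc).le
        exact (add_le_add (htri.trans hrestart) hlarge).trans le_self_add
    have hsum := Finset.sum_le_sum fun ε (_ : ε ∈ Finset.univ) => hchild ε
    simpa only [Finset.sum_add_distrib, ← Finset.mul_sum, ← lintegral_eq_sum_child,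
      ← volume_eq_sum_child] using hsum

end Oscillation

/-- The local estimate: on each cube, the weighted oscillation of `b` is controlled by the integral
of the maximal function of the localized weight. -/
lemma lintegral_sub_cubeAvg_mul_le {n : ℕ} {v b : (Fin n → ℝ) → ℝ} (hv : IsWeight v)
    (hb : LocallyIntegrable b volume) (hbmo : bmoNorm b ≠ ⊤) (a : Fin n → ℝ) {h : ℝ}
    (hh : 0 < h) :
    ∫⁻ x in Cube a h, ENNReal.ofReal (|b x - cubeAvg a h b| * v x) ≤
      4 * (1 + 2 ^ n) * (∫⁻ x in Cube a h, maxFn ((Cube a h).indicator v) x) * bmoNorm b := by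
  obtain ⟨hv0, hvi⟩ := hv
  set c := cubeAvg a h b
  set F := maxFn ((Cube a h).indicator v)
  set w : (Fin n → ℝ) → ℝ≥0∞ := fun x => ENNReal.ofReal (v x)
  have hw : AEMeasurable w volume := hvi.aestronglyMeasurable.aemeasurable.ennreal_ofReal
  have hwfin : ∀ a h, ∫⁻ x in HalfOpenCube a h, w x ≠ ⊤ := by
    intro a h
    rw [← restrict_cube]
    exact (integrableOn_cube_of_locallyIntegrable hvi).lintegral_lt_top.ne
  have hF : ∀ a' h', 0 < h' → HalfOpenCube a' h' ⊆ HalfOpenCube a h → ∀ x ∈ HalfOpenCube a' h',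
      (∫⁻ y in HalfOpenCube a' h', w y) / volume (HalfOpenCube a' h') ≤ F x := by
    intro a' h' hh' hsub x hx
    refine le_iSup₂_of_le a' h' (le_iSup₂_of_le hh' (halfOpenCube_subset_cube hx) ?_)
    rw [restrict_cube, volume_cube, volume_halfOpenCube]
    gcongr ?_ / _
    refine setLIntegral_mono' measurableSet_halfOpenCube fun y hy => ?_
    rw [indicator_of_mem (halfOpenCube_subset_cube (hsub hy)), abs_of_nonneg (hv0 y)]
  have hosc := lintegral_sub_cubeAvg_le (a := a) b hh
  have hbound : ∀ N, ∫⁻ x in HalfOpenCube a h, ENNReal.ofReal |dyadicAvg b N a h x - c| * w x ≤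
      2 * bmoNorm b * (2 * (1 + 2 ^ n)) * ∫⁻ x in HalfOpenCube a h, F x := by
    intro N
    refine le_self_add.trans (lintegral_add_le_of_restart (E := 2 ^ n) hbmo (hwfin a h)
      (by finiteness) rfl (ENNReal.div_mul_cancel (volume_halfOpenCube_ne_zero hh)
        volume_halfOpenCube_ne_top) hosc
      (lintegral_dyadicAvg_sub_mul_le hb hbmo hw hwfin hF N a h c _ hh subset_rfl
        (hF a h hh subset_rfl) (hosc.trans ?_)))
    gcongr
    exact le_mul_of_one_le_left zero_le one_le_two
  rw [restrict_cube]
  calc ∫⁻ x in HalfOpenCube a h, ENNReal.ofReal (|b x - c| * v x)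
      = ∫⁻ x in HalfOpenCube a h, Filter.liminf
          (fun N => ENNReal.ofReal |dyadicAvg b N a h x - c| * w x) Filter.atTop := by
        refine lintegral_congr_ae (ae_restrict_of_ae ?_)
        filter_upwards [ae_tendsto_dyadicAvg (a := a) hb hh] with x hx
        have ht := ENNReal.Tendsto.mul_const (b := w x)
          (ENNReal.tendsto_ofReal (hx.sub_const c).abs) (Or.inr ENNReal.ofReal_ne_top)
        rw [ht.liminf_eq, ENNReal.ofReal_mul (abs_nonneg _)]
    _ ≤ Filter.liminf (fun N => ∫⁻ x in HalfOpenCube a h,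
          ENNReal.ofReal |dyadicAvg b N a h x - c| * w x) Filter.atTop := by
        refine lintegral_liminf_le' fun N => AEMeasurable.mul ?_ hw.restrict
        have := measurable_dyadicAvg b N a h
        fun_prop
    _ ≤ 2 * bmoNorm b * (2 * (1 + 2 ^ n)) * ∫⁻ x in HalfOpenCube a h, F x :=
        Filter.liminf_le_of_frequently_le'
          (Filter.Frequently.of_forall hbound)
    _ = _ := by ring

/-- for every weight `v` and cube functional `Y`, the embedding
`BMO ↪ BMO_{v,Y}` holds with norm at most a dimensional constant times `[v]_{A∞,Y}`. -/
theorem stmt0 (n : ℕ) :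
    ∃ C : ℝ, 0 < C ∧
      ∀ (v : (Fin n → ℝ) → ℝ) (Y : (Fin n → ℝ) → ℝ → ℝ≥0∞) (b : (Fin n → ℝ) → ℝ),
        IsWeight v → IsCubeFunctional Y →
        LocallyIntegrable b volume → bmoNorm b < ⊤ →
        bmoVY v Y b ≤ ENNReal.ofReal C * fwY v Y * bmoNorm b := by
  refine ⟨4 * (1 + 2 ^ n), by positivity, fun v Y b hv _ hb hbmo => ?_⟩
  have hC : ENNReal.ofReal (4 * (1 + 2 ^ n)) = 4 * (1 + 2 ^ n) := by
    rw [ENNReal.ofReal_mul (by norm_num), ENNReal.ofReal_add (by norm_num) (by positivity),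
      ENNReal.ofReal_pow (by norm_num)]
    simp
  rw [hC]
  refine iSup₂_le fun a h => iSup_le fun hh => ?_
  have hfw : (∫⁻ x in Cube a h, maxFn ((Cube a h).indicator v) x) / Y a h ≤ fwY v Y :=
    le_iSup₂_of_le a h (le_iSup_of_le hh le_rfl)
  calc _ ≤ 4 * (1 + 2 ^ n) * (∫⁻ x in Cube a h, maxFn ((Cube a h).indicator v) x) *
        bmoNorm b / Y a h := by
        gcongr
        exact lintegral_sub_cubeAvg_mul_le hv hb hbmo.ne a hh
    _ = 4 * (1 + 2 ^ n) * ((∫⁻ x in Cube a h, maxFn ((Cube a h).indicator v) x) / Y a h) *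
        bmoNorm b := by
        simp only [div_eq_mul_inv]
        ring
    _ ≤ _ := by gcongr
end
end

section
/- Let w be a weight on ℝⁿ, q > 1, and Y : 𝒬 → (0,∞) a functional belonging to the class 𝒴_q with constant β_Y, and suppose that w(Q) ≤ Y(Q) for every cube Q. Then there is a dimensional constant c such that for every f ∈ BMO, every cube Q, and every p ≥ 1, ( (1/Y(Q)) ∫_Q |f − f_Q|^p w dx )^{1/p} ≤ c · p · q · β_Y · ‖f‖_{BMO}. -/
open MeasureTheory ENNReal Set

noncomputable section

open Filter Topology

namespace DyadicCube

variable {n : ℕ}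

/-- The half-open cube with lower corner `a` and side length `h`. -/
def halfCube (a : Fin n → ℝ) (h : ℝ) : Set (Fin n → ℝ) :=
  Set.univ.pi fun i => Set.Ico (a i) (a i + h)

lemma measurableSet_halfCube (a : Fin n → ℝ) (h : ℝ) : MeasurableSet (halfCube a h) :=
  MeasurableSet.univ_pi fun _ => measurableSet_Ico

lemma halfCube_ae_eq_cube (a : Fin n → ℝ) (h : ℝ) : halfCube a h =ᵐ[volume] Cube a h :=
  Measure.pi_Ico_ae_eq_pi_Icc

lemma restrict_halfCube (a : Fin n → ℝ) (h : ℝ) :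
    (volume : Measure (Fin n → ℝ)).restrict (halfCube a h) = volume.restrict (Cube a h) :=
  Measure.restrict_congr_set (halfCube_ae_eq_cube a h)

lemma cube_eq_Icc (a : Fin n → ℝ) (h : ℝ) : Cube a h = Set.Icc a (fun i => a i + h) :=
  Set.pi_univ_Icc a _

lemma volume_cube (a : Fin n → ℝ) (h : ℝ) : volume (Cube a h) = ENNReal.ofReal h ^ n := by
  rw [cube_eq_Icc, Real.volume_Icc_pi]
  simp

lemma volume_cube_ne_zero (a : Fin n → ℝ) {h : ℝ} (hh : 0 < h) : volume (Cube a h) ≠ 0 := by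
  rw [volume_cube]
  exact pow_ne_zero _ (by simpa using hh)

lemma volume_cube_ne_top (a : Fin n → ℝ) (h : ℝ) : volume (Cube a h) ≠ ⊤ := by
  rw [volume_cube]
  exact ENNReal.pow_ne_top ENNReal.ofReal_ne_top

lemma measurableSet_cube (a : Fin n → ℝ) (h : ℝ) : MeasurableSet (Cube a h) :=
  MeasurableSet.univ_pi fun _ => measurableSet_Icc

lemma isCompact_cube (a : Fin n → ℝ) (h : ℝ) : IsCompact (Cube a h) :=
  isCompact_univ_pi fun _ => isCompact_Icc

lemma cube_eq_closedBall (a : Fin n → ℝ) {h : ℝ} (hh : 0 ≤ h) :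
    Cube a h = Metric.closedBall (fun i => a i + h / 2) (h / 2) := by
  rw [closedBall_pi _ (by positivity)]
  simp only [Cube, Real.closedBall_eq_Icc]
  congr! 3 <;> ring

lemma closure_halfCube (a : Fin n → ℝ) {h : ℝ} (hh : 0 < h) :
    closure (halfCube a h) = Cube a h := by
  simp only [halfCube, Cube, closure_pi_set]
  congr! 2 with i
  exact closure_Ico (by linarith)

lemma interior_cube_subset (a : Fin n → ℝ) (h : ℝ) : interior (Cube a h) ⊆ halfCube a h := by
  simp only [halfCube, Cube, interior_pi_set Set.finite_univ, interior_Icc]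
  exact Set.pi_mono fun i _ => Set.Ioo_subset_Ico_self

/-- Side length of the dyadic cells of level `k` relative to a cube of side length `h`. -/
def side (h : ℝ) (k : ℕ) : ℝ := h / 2 ^ k

lemma side_pos {h : ℝ} (hh : 0 < h) (k : ℕ) : 0 < side h k := by
  unfold side; positivity

/-- Lower corner of the dyadic cell `P`, consisting of a level and integer coordinates. -/
def corner (a : Fin n → ℝ) (h : ℝ) (P : ℕ × (Fin n → ℤ)) : Fin n → ℝ :=
  fun i => a i + P.2 i * side h P.1

/-- The half-open dyadic cell `P` of the grid generated by the cube with corner `a`, side `h`. -/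
def cell (a : Fin n → ℝ) (h : ℝ) (P : ℕ × (Fin n → ℤ)) : Set (Fin n → ℝ) :=
  halfCube (corner a h P) (side h P.1)

/-- The closed dyadic cube `P` of the grid generated by the cube with corner `a`, side `h`. -/
def closedCell (a : Fin n → ℝ) (h : ℝ) (P : ℕ × (Fin n → ℤ)) : Set (Fin n → ℝ) :=
  Cube (corner a h P) (side h P.1)

/-- The coordinates of the level `k` cell that contains `x`. -/
def index (a : Fin n → ℝ) (h : ℝ) (k : ℕ) (x : Fin n → ℝ) : Fin n → ℤ :=
  fun i => ⌊(x i - a i) / side h k⌋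

/-- The ancestor at level `j` of the cell `P`. -/
def coarsen (j : ℕ) (P : ℕ × (Fin n → ℤ)) : ℕ × (Fin n → ℤ) :=
  (j, fun i => P.2 i / 2 ^ (P.1 - j))

/-- The cell of level zero, which is the generating cube itself. -/
def root : ℕ × (Fin n → ℤ) := (0, 0)

lemma restrict_cell (a : Fin n → ℝ) (h : ℝ) (P : ℕ × (Fin n → ℤ)) :
    (volume : Measure (Fin n → ℝ)).restrict (cell a h P) = volume.restrict (closedCell a h P) :=
  restrict_halfCube _ _

lemma volume_cell (a : Fin n → ℝ) (h : ℝ) (P : ℕ × (Fin n → ℤ)) :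
    volume (cell a h P) = volume (closedCell a h P) :=
  measure_congr (halfCube_ae_eq_cube _ _)

lemma measurableSet_cell (a : Fin n → ℝ) (h : ℝ) (P : ℕ × (Fin n → ℤ)) :
    MeasurableSet (cell a h P) :=
  measurableSet_halfCube _ _

lemma corner_root (a : Fin n → ℝ) (h : ℝ) : corner a h root = a := by
  ext i; simp [corner, root]

lemma cell_root (a : Fin n → ℝ) (h : ℝ) : cell a h root = halfCube a h := by
  rw [cell, corner_root]
  simp [side, root]

lemma closedCell_root (a : Fin n → ℝ) (h : ℝ) : closedCell a h root = Cube a h := by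
  rw [closedCell, corner_root]
  simp [side, root]

lemma mem_cell_iff {a : Fin n → ℝ} {h : ℝ} (hh : 0 < h) {P : ℕ × (Fin n → ℤ)}
    {x : Fin n → ℝ} : x ∈ cell a h P ↔ index a h P.1 x = P.2 := by
  have hs := side_pos hh P.1
  simp only [cell, halfCube, corner, index, Set.mem_univ_pi, Set.mem_Ico, funext_iff,
    Int.floor_eq_iff, le_div_iff₀ hs, div_lt_iff₀ hs]
  refine forall_congr' fun i => and_congr ⟨fun H => by linarith, fun H => by linarith⟩
    ⟨fun H => by linarith, fun H => by linarith⟩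

lemma coarsen_index (a : Fin n → ℝ) (h : ℝ) {j k : ℕ} (hjk : j ≤ k) (x : Fin n → ℝ) :
    coarsen j (k, index a h k x) = (j, index a h j x) := by
  simp only [coarsen, index, Prod.mk.injEq, true_and]
  ext i
  have : (x i - a i) / side h j = (x i - a i) / side h k / ((2 ^ (k - j) : ℕ) : ℝ) := by
    obtain ⟨d, rfl⟩ := Nat.exists_eq_add_of_le hjk
    simp only [side, add_tsub_cancel_left]
    push_cast
    rw [pow_add]
    field_simp
  change _ = ⌊(x i - a i) / side h j⌋
  rw [this, Int.floor_div_natCast]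
  push_cast
  rfl

lemma mem_cell_coarsen {a : Fin n → ℝ} {h : ℝ} (hh : 0 < h) {j : ℕ} {P : ℕ × (Fin n → ℤ)}
    (hj : j ≤ P.1) {x : Fin n → ℝ} (hx : x ∈ cell a h P) : x ∈ cell a h (coarsen j P) := by
  rw [mem_cell_iff hh] at hx ⊢
  have hP : P = (P.1, index a h P.1 x) := by rw [hx]
  rw [hP, coarsen_index a h hj]

lemma coarsen_coarsen {i j : ℕ} {P : ℕ × (Fin n → ℤ)} (hij : i ≤ j) (hj : j ≤ P.1) :
    coarsen i (coarsen j P) = coarsen i P := by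
  simp only [coarsen, Prod.mk.injEq, true_and]
  ext l
  rw [Int.ediv_ediv_of_nonneg (by positivity), ← pow_add]
  congr 2
  omega

lemma coarsen_self (P : ℕ × (Fin n → ℤ)) : coarsen P.1 P = P := by
  ext <;> simp [coarsen]

lemma closedCell_subset_coarsen {a : Fin n → ℝ} {h : ℝ} (hh : 0 < h) {j : ℕ}
    {P : ℕ × (Fin n → ℤ)} (hj : j ≤ P.1) :
    closedCell a h P ⊆ closedCell a h (coarsen j P) := by
  rw [closedCell, closedCell, ← closure_halfCube _ (side_pos hh _),
    ← closure_halfCube _ (side_pos hh _)]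
  exact closure_mono fun x hx => mem_cell_coarsen hh hj hx

lemma eq_coarsen_of_mem {a : Fin n → ℝ} {h : ℝ} (hh : 0 < h) {P R : ℕ × (Fin n → ℤ)}
    (hPR : P.1 ≤ R.1) {x : Fin n → ℝ} (hP : x ∈ cell a h P) (hR : x ∈ cell a h R) :
    coarsen P.1 R = P := by
  have h1 := mem_cell_coarsen hh hPR hR
  rw [mem_cell_iff hh] at h1 hP
  exact Prod.ext rfl (h1.symm.trans hP)

lemma corner_side_injective (a : Fin n → ℝ) {h : ℝ} (hh : 0 < h) :
    Function.Injective fun P : ℕ × (Fin n → ℤ) => (corner a h P, side h P.1) := by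
  rintro ⟨k, m⟩ ⟨l, r⟩ H
  simp only [Prod.mk.injEq] at H
  obtain ⟨hc, hs⟩ := H
  have hkl : k = l := by
    have h2 : (2 : ℝ) ^ k = 2 ^ l := by
      simp only [side] at hs
      field_simp at hs
      exact hs.symm
    exact Nat.pow_right_injective le_rfl (by exact_mod_cast h2)
  subst hkl
  ext i
  · rfl
  · have := congrFun hc i
    simpa [corner, (side_pos hh k).ne'] using this

lemma volume_closedCell_parent (a : Fin n → ℝ) {h : ℝ} (hh : 0 < h) {k : ℕ}
    {P : ℕ × (Fin n → ℤ)} (hP : P.1 = k + 1) :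
    volume (closedCell a h (coarsen k P)) = 2 ^ n * volume (closedCell a h P) := by
  have : side h k = 2 * side h P.1 := by simp only [side, hP]; rw [pow_succ]; field_simp
  simp only [closedCell, volume_cube]
  rw [show (coarsen k P).1 = k from rfl, this, ENNReal.ofReal_mul (by norm_num), mul_pow]
  simp

/-- The maximal cells of the grid below the root at which `E` exceeds the height `t`. -/
def stopping (E : ℕ × (Fin n → ℤ) → ℝ≥0∞) (t : ℝ≥0∞) : Set (ℕ × (Fin n → ℤ)) :=
  {P | coarsen 0 P = root ∧ t < E P ∧ ∀ j < P.1, E (coarsen j P) ≤ t}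

lemma exists_coarsen_mem_stopping {E : ℕ × (Fin n → ℤ) → ℝ≥0∞} {t : ℝ≥0∞}
    {P : ℕ × (Fin n → ℤ)} (h0 : coarsen 0 P = root) (ht : t < E P) :
    ∃ j ≤ P.1, coarsen j P ∈ stopping E t := by
  classical
  have hex : ∃ j, j ≤ P.1 ∧ t < E (coarsen j P) := ⟨P.1, le_rfl, by rwa [coarsen_self]⟩
  obtain ⟨hj, hlt⟩ := Nat.find_spec hex
  refine ⟨Nat.find hex, hj, ?_, hlt, fun i hi => ?_⟩
  · rw [coarsen_coarsen (Nat.zero_le _) hj, h0]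
  · have hi' : i < Nat.find hex := hi
    have := Nat.find_min hex hi'
    rw [coarsen_coarsen hi'.le hj]
    exact not_lt.1 fun H => this ⟨hi'.le.trans hj, H⟩

lemma pairwiseDisjoint_stopping (a : Fin n → ℝ) {h : ℝ} (hh : 0 < h)
    (E : ℕ × (Fin n → ℤ) → ℝ≥0∞) (t : ℝ≥0∞) :
    (stopping E t).PairwiseDisjoint (cell a h) := by
  intro P hP R hR hne
  refine Set.disjoint_left.2 fun x hxP hxR => ?_
  wlog hle : P.1 ≤ R.1 generalizing P R
  · exact this hR hP hne.symm hxR hxP (by omega)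
  have hc := eq_coarsen_of_mem hh hle hxP hxR
  rcases hle.lt_or_eq with hlt | heq
  · have := hR.2.2 _ hlt
    rw [hc] at this
    exact this.not_gt hP.2.1
  · rw [heq, coarsen_self] at hc
    exact hne hc.symm

lemma cell_subset_of_mem_stopping {a : Fin n → ℝ} {h : ℝ} (hh : 0 < h)
    {E : ℕ × (Fin n → ℤ) → ℝ≥0∞} {t : ℝ≥0∞} {P : ℕ × (Fin n → ℤ)} (hP : P ∈ stopping E t) :
    cell a h P ⊆ halfCube a h := by
  intro x hx
  rw [← cell_root, ← hP.1]
  exact mem_cell_coarsen hh (Nat.zero_le _) hx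

lemma closedCell_subset_of_mem_stopping {a : Fin n → ℝ} {h : ℝ} (hh : 0 < h)
    {E : ℕ × (Fin n → ℤ) → ℝ≥0∞} {t : ℝ≥0∞} {P : ℕ × (Fin n → ℤ)} (hP : P ∈ stopping E t) :
    closedCell a h P ⊆ Cube a h := by
  rw [← closedCell_root, ← hP.1]
  exact closedCell_subset_coarsen hh (Nat.zero_le _)

lemma tsum_lintegral_closedCell_le (a : Fin n → ℝ) (h : ℝ) {S : Set (ℕ × (Fin n → ℤ))}
    (hd : S.PairwiseDisjoint (cell a h)) {T : Set (Fin n → ℝ)} (hT : ∀ P ∈ S, cell a h P ⊆ T)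
    (F : (Fin n → ℝ) → ℝ≥0∞) :
    ∑' P : S, ∫⁻ x in closedCell a h P, F x ≤ ∫⁻ x in T, F x := by
  have := lintegral_biUnion (μ := volume) S.to_countable
    (fun P _ => measurableSet_cell a h P) hd F
  simp only [restrict_cell] at this
  rw [← this]
  exact lintegral_mono_set (Set.iUnion₂_subset hT)

/-- The mean of `|f - c|` over the dyadic cube `P`. -/
def meanDist (f : (Fin n → ℝ) → ℝ) (c : ℝ) (a : Fin n → ℝ) (h : ℝ) (P : ℕ × (Fin n → ℤ)) :
    ℝ≥0∞ :=
  (∫⁻ x in closedCell a h P, ENNReal.ofReal |f x - c|) / volume (closedCell a h P)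

lemma ofReal_abs_cubeAvg_sub_le {f : (Fin n → ℝ) → ℝ} (hf : LocallyIntegrable f volume)
    (a : Fin n → ℝ) {h : ℝ} (hh : 0 < h) (c : ℝ) :
    ENNReal.ofReal |cubeAvg a h f - c| ≤
      (∫⁻ x in Cube a h, ENNReal.ofReal |f x - c|) / volume (Cube a h) := by
  have hv0 := volume_cube_ne_zero a hh
  have hvt := volume_cube_ne_top a h
  have hfi : IntegrableOn f (Cube a h) := hf.integrableOn_isCompact (isCompact_cube a h)
  have hci : IntegrableOn (fun _ => c) (Cube a h) := integrableOn_const hvt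
  have hconst : ⨍ _ in Cube a h, c = c := setAverage_const hv0 hvt c
  have hsub : cubeAvg a h f - c = ⨍ x in Cube a h, (f x - c) := by
    conv_lhs => rw [← hconst]
    simp only [cubeAvg, setAverage_eq]
    rw [integral_sub hfi hci, smul_sub]
  rw [hsub, ← Real.enorm_eq_ofReal_abs]
  refine (enorm_integral_le_lintegral_enorm _).trans_eq ?_
  simp only [lintegral_smul_measure, Measure.restrict_apply_univ, Real.enorm_eq_ofReal_abs,
    smul_eq_mul, div_eq_mul_inv]
  rw [mul_comm]

lemma lintegral_sub_cubeAvg_le {f : (Fin n → ℝ) → ℝ} {b : ℝ≥0∞} (hb : bmoNorm f ≤ b)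
    (a : Fin n → ℝ) {h : ℝ} (hh : 0 < h) :
    ∫⁻ x in Cube a h, ENNReal.ofReal |f x - cubeAvg a h f| ≤ b * volume (Cube a h) := by
  rw [← ENNReal.div_le_iff (volume_cube_ne_zero a hh) (volume_cube_ne_top a h)]
  refine le_trans ?_ hb
  unfold bmoNorm
  refine le_iSup_of_le a (le_iSup_of_le h ?_)
  rw [iSup_pos hh]

lemma ofReal_abs_sub_le (x y z : ℝ) :
    ENNReal.ofReal |x - z| ≤ ENNReal.ofReal |x - y| + ENNReal.ofReal |y - z| := by
  rw [← ENNReal.ofReal_add (abs_nonneg _) (abs_nonneg _)]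
  exact ENNReal.ofReal_le_ofReal (abs_sub_le x y z)

/-- The average of `f` over a stopping cube is controlled by the stopping height. -/
lemma ofReal_abs_cubeAvg_sub_le_of_mem_stopping {f : (Fin n → ℝ) → ℝ}
    (hf : LocallyIntegrable f volume) {b : ℝ≥0∞} (hb : bmoNorm f ≤ b) (a : Fin n → ℝ) {h : ℝ}
    (hh : 0 < h) {s : ℝ≥0∞} {P : ℕ × (Fin n → ℤ)}
    (hP : P ∈ stopping (meanDist f (cubeAvg a h f) a h) s) :
    ENNReal.ofReal |cubeAvg (corner a h P) (side h P.1) f - cubeAvg a h f| ≤ 2 ^ n * b + s := by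
  obtain ⟨h0, -, hmax⟩ := hP
  rcases hk : P.1 with _ | k
  · have hPr : P = root := by rw [← h0, ← hk, coarsen_self]
    rw [hPr, corner_root]
    simp [side]
  · set R := coarsen k P with hR
    have hRs := side_pos hh R.1
    have hsub : closedCell a h P ⊆ closedCell a h R := closedCell_subset_coarsen hh (by omega)
    have hvol := volume_closedCell_parent a hh hk
    rw [← hk]
    have h1 : ENNReal.ofReal |cubeAvg (corner a h P) (side h P.1) f -
        cubeAvg (corner a h R) (side h R.1) f| ≤ 2 ^ n * b := by
      refine (ofReal_abs_cubeAvg_sub_le hf _ (side_pos hh _) _).trans ?_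
      refine ENNReal.div_le_of_le_mul ?_
      refine (lintegral_mono_set hsub).trans ((lintegral_sub_cubeAvg_le hb _ hRs).trans_eq ?_)
      change b * volume (closedCell a h R) = _ * volume (closedCell a h P)
      rw [hvol]
      ring
    have h2 : ENNReal.ofReal |cubeAvg (corner a h R) (side h R.1) f - cubeAvg a h f| ≤ s :=
      (ofReal_abs_cubeAvg_sub_le hf _ hRs _).trans (hmax k (by omega))
    exact (ofReal_abs_sub_le _ _ _).trans (add_le_add h1 h2)

/-- Raising the stopping height by `(2 ^ n + 2) b` halves the total volume. -/
lemma tsum_volume_stopping_succ_le {f : (Fin n → ℝ) → ℝ}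
    (hf : LocallyIntegrable f volume) {b : ℝ≥0∞} (hb : bmoNorm f ≤ b) (hb0 : b ≠ 0)
    (hbt : b ≠ ⊤) (a : Fin n → ℝ) {h : ℝ} (hh : 0 < h) {s : ℝ≥0∞} (hs : s ≠ ⊤) :
    ∑' R : stopping (meanDist f (cubeAvg a h f) a h) (s + (2 ^ n + 2) * b),
        volume (closedCell a h R) ≤
      (∑' P : stopping (meanDist f (cubeAvg a h f) a h) s, volume (closedCell a h P)) / 2 := by
  set E := meanDist f (cubeAvg a h f) a h with hE
  set t := s + (2 ^ n + 2) * b with ht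
  have hst : s ≤ t := le_self_add
  let below : ℕ × (Fin n → ℤ) → Set (ℕ × (Fin n → ℤ)) := fun P =>
    {R | R ∈ stopping E t ∧ P.1 ≤ R.1 ∧ coarsen P.1 R = P}
  have hcover : stopping E t ⊆ ⋃ P ∈ stopping E s, below P := by
    intro R hR
    obtain ⟨j, hj, hmem⟩ := exists_coarsen_mem_stopping hR.1 (hst.trans_lt hR.2.1)
    exact Set.mem_biUnion hmem ⟨hR, hj, rfl⟩
  have hlocal : ∀ P ∈ stopping E s, ∑' R : below P, volume (closedCell a h R) ≤
      volume (closedCell a h P) / 2 := by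
    intro P hP
    set m := cubeAvg (corner a h P) (side h P.1) f with hm
    have hdist := ofReal_abs_cubeAvg_sub_le_of_mem_stopping hf hb a hh hP
    have hone : ∀ R : below P, 2 * b * volume (closedCell a h R) ≤
        ∫⁻ x in closedCell a h R, ENNReal.ofReal |f x - m| := by
      rintro ⟨R, hR, -⟩
      have hv0 : volume (closedCell a h R) ≠ 0 := volume_cube_ne_zero _ (side_pos hh _)
      have hvt : volume (closedCell a h R) ≠ ⊤ := volume_cube_ne_top _ _
      have h1 : t * volume (closedCell a h R) ≤
          ∫⁻ x in closedCell a h R, ENNReal.ofReal |f x - cubeAvg a h f| :=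
        (ENNReal.le_div_iff_mul_le (Or.inl hv0) (Or.inl hvt)).1 hR.2.1.le
      have h2 : ∫⁻ x in closedCell a h R, ENNReal.ofReal |f x - cubeAvg a h f| ≤
          (∫⁻ x in closedCell a h R, ENNReal.ofReal |f x - m|) +
            (2 ^ n * b + s) * volume (closedCell a h R) := by
        rw [← setLIntegral_const, ← lintegral_add_right _ measurable_const]
        exact lintegral_mono fun x => (ofReal_abs_sub_le _ m _).trans (by gcongr)
      have h3 := h1.trans h2
      have ht' : t * volume (closedCell a h R) = 2 * b * volume (closedCell a h R) +
          (2 ^ n * b + s) * volume (closedCell a h R) := by rw [ht]; ring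
      rw [ht'] at h3
      refine (ENNReal.add_le_add_iff_right ?_).1 h3
      finiteness
    have hsum : 2 * b * ∑' R : below P, volume (closedCell a h R) ≤
        b * volume (closedCell a h P) := by
      rw [← ENNReal.tsum_mul_left]
      refine (ENNReal.tsum_le_tsum hone).trans ?_
      refine (tsum_lintegral_closedCell_le a h
        ((pairwiseDisjoint_stopping a hh E t).subset fun R hR => hR.1)
        (T := cell a h P) ?_ _).trans ?_
      · rintro R ⟨-, hle, hc⟩ x hx
        rw [← hc]
        exact mem_cell_coarsen hh hle hx
      · rw [restrict_cell]
        exact lintegral_sub_cubeAvg_le hb _ (side_pos hh _)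
    rw [ENNReal.le_div_iff_mul_le (by simp) (by simp)]
    rw [mul_comm 2 b, mul_assoc] at hsum
    rw [mul_comm]
    exact (ENNReal.mul_le_mul_iff_right hb0 hbt).1 hsum
  calc ∑' R : stopping E t, volume (closedCell a h R)
      ≤ ∑' R : ⋃ P ∈ stopping E s, below P, volume (closedCell a h R) :=
        ENNReal.tsum_mono_subtype (fun R => volume (closedCell a h R)) hcover
    _ ≤ ∑' P : stopping E s, ∑' R : below P, volume (closedCell a h R) :=
        ENNReal.tsum_biUnion_le_tsum (fun R => volume (closedCell a h R)) (stopping E s) below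
    _ ≤ ∑' P : stopping E s, volume (closedCell a h P) / 2 :=
        ENNReal.tsum_le_tsum fun P => hlocal P P.2
    _ = _ := by simp only [div_eq_mul_inv, ENNReal.tsum_mul_right]

lemma tsum_volume_stopping_le {f : (Fin n → ℝ) → ℝ}
    (hf : LocallyIntegrable f volume) {b : ℝ≥0∞} (hb : bmoNorm f ≤ b) (hb0 : b ≠ 0)
    (hbt : b ≠ ⊤) (a : Fin n → ℝ) {h : ℝ} (hh : 0 < h) (k : ℕ) :
    ∑' P : stopping (meanDist f (cubeAvg a h f) a h) (k * ((2 ^ n + 2) * b)),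
        volume (closedCell a h P) ≤ volume (Cube a h) / 2 ^ k := by
  induction k with
  | zero =>
    have := tsum_lintegral_closedCell_le a h (pairwiseDisjoint_stopping a hh
      (meanDist f (cubeAvg a h f) a h) ((0 : ℕ) * ((2 ^ n + 2) * b)))
      (fun P hP => cell_subset_of_mem_stopping hh hP) (fun _ => 1)
    simpa [restrict_halfCube, measure_congr (halfCube_ae_eq_cube a h)] using this
  | succ k ih =>
    have := tsum_volume_stopping_succ_le hf hb hb0 hbt a hh
      (s := k * ((2 ^ n + 2) * b)) (by finiteness)
    rw [show (k * ((2 ^ n + 2) * b) + (2 ^ n + 2) * b : ℝ≥0∞) =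
      ((k + 1 : ℕ) : ℝ≥0∞) * ((2 ^ n + 2) * b) by push_cast; ring] at this
    refine this.trans ((ENNReal.div_le_div_right ih 2).trans_eq ?_)
    rw [pow_succ, div_eq_mul_inv, div_eq_mul_inv, div_eq_mul_inv, mul_assoc,
      ENNReal.mul_inv (by simp) (by simp)]

/-- Almost every point at which `|f - c|` exceeds `t` lies in a stopping cell. -/
lemma ae_mem_iUnion_stopping {f : (Fin n → ℝ) → ℝ} (hf : LocallyIntegrable f volume) (c : ℝ)
    (a : Fin n → ℝ) {h : ℝ} (hh : 0 < h) :
    ∀ᵐ x, x ∈ halfCube a h → ∀ t, t < ENNReal.ofReal |f x - c| →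
      x ∈ ⋃ P ∈ stopping (meanDist f c a h) t, cell a h P := by
  have hg : LocallyIntegrable (fun x => |f x - c|) volume := fun x =>
    let ⟨s, hs, hi⟩ := hf.sub (locallyIntegrable_const c) x
    ⟨s, hs, hi.norm⟩
  filter_upwards [IsUnifLocDoublingMeasure.ae_tendsto_average volume hg 1] with x hx hxQ t htx
  let P : ℕ → ℕ × (Fin n → ℤ) := fun k => (k, index a h k x)
  have hmem : ∀ k, x ∈ cell a h (P k) := fun k => (mem_cell_iff hh).2 rfl
  have hside : Tendsto (fun k => side h k / 2) atTop (𝓝[>] 0) := by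
    refine tendsto_nhdsWithin_iff.2 ⟨?_, .of_forall fun k => half_pos (side_pos hh k)⟩
    have := ((tendsto_pow_atTop_nhds_zero_of_lt_one (r := (1 / 2 : ℝ)) (by norm_num)
      (by norm_num)).const_mul h).div_const 2
    simpa [side, div_eq_mul_inv] using this
  have hlim := hx (l := atTop) (fun k i => corner a h (P k) i + side h k / 2)
    (fun k => side h k / 2) hside (.of_forall fun k => by
      rw [one_mul, ← cube_eq_closedBall _ (side_pos hh k).le]
      exact subset_closure.trans_eq (closure_halfCube _ (side_pos hh k)) (hmem k))
  have hE : ∀ k, ENNReal.ofReal (⨍ y in Metric.closedBall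
      (fun i => corner a h (P k) i + side h k / 2) (side h k / 2), |f y - c|) =
      meanDist f c a h (P k) := by
    intro k
    rw [← cube_eq_closedBall _ (side_pos hh k).le,
      ofReal_setAverage (hg.integrableOn_isCompact (isCompact_cube _ _))
        (.of_forall fun _ => abs_nonneg _)]
    rfl
  have hlim' := (ENNReal.continuous_ofReal.tendsto _).comp hlim
  obtain ⟨k, hk⟩ := (hlim'.eventually (lt_mem_nhds htx)).exists
  simp only [Function.comp, hE] at hk
  have hroot : coarsen 0 (P k) = root := by
    rw [coarsen_index a h (Nat.zero_le k)]
    rw [← cell_root, mem_cell_iff hh] at hxQ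
    exact Prod.ext rfl hxQ
  obtain ⟨j, hj, hS⟩ := exists_coarsen_mem_stopping hroot hk
  exact Set.mem_biUnion hS (mem_cell_coarsen hh hj (hmem k))

/-- Almost everywhere, `|f - c|` is bounded by `K` times the number of stopping levels reached. -/
lemma ae_ofReal_abs_sub_le_tsum {f : (Fin n → ℝ) → ℝ} (hf : LocallyIntegrable f volume) (c : ℝ)
    (a : Fin n → ℝ) {h : ℝ} (hh : 0 < h) {K : ℝ≥0∞} (hK0 : K ≠ 0) (hKt : K ≠ ⊤) :
    ∀ᵐ x, x ∈ halfCube a h → ENNReal.ofReal |f x - c| ≤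
      K * ∑' k : ℕ, (⋃ P ∈ stopping (meanDist f c a h) (k * K), cell a h P).indicator 1 x := by
  filter_upwards [ae_mem_iUnion_stopping hf c a hh] with x hx hxQ
  set g := ENNReal.ofReal |f x - c| with hg
  have hgt : g / K ≠ ⊤ := ENNReal.div_ne_top ENNReal.ofReal_ne_top hK0
  obtain ⟨N, hN, hmin⟩ : ∃ N : ℕ, g / K ≤ N ∧ ∀ k < N, (k : ℝ≥0∞) < g / K := by
    classical
    have hex : ∃ N : ℕ, g / K ≤ N := (ENNReal.exists_nat_gt hgt).imp fun _ => le_of_lt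
    exact ⟨Nat.find hex, Nat.find_spec hex, fun k hk => not_le.1 (Nat.find_min hex hk)⟩
  rw [mul_comm]
  refine (ENNReal.div_le_iff hK0 hKt).1 (hN.trans ?_)
  refine le_trans (le_of_eq ?_) (ENNReal.sum_le_tsum (Finset.range N))
  rw [Finset.sum_congr rfl fun k hk => Set.indicator_of_mem (hx hxQ _ ?_) 1]
  · simp
  · have := hmin k (Finset.mem_range.1 hk)
    rwa [ENNReal.lt_div_iff_mul_lt (Or.inl hK0) (Or.inl hKt)] at this

end DyadicCube

lemma lintegral_rpow_sum_le {α : Type*} [MeasurableSpace α] {μ : Measure α} {p : ℝ} (hp : 1 ≤ p)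
    {F : ℕ → α → ℝ≥0∞} (hF : ∀ k, Measurable (F k)) (N : ℕ) :
    (∫⁻ x, (∑ k ∈ Finset.range N, F k x) ^ p ∂μ) ^ (1 / p) ≤
      ∑ k ∈ Finset.range N, (∫⁻ x, F k x ^ p ∂μ) ^ (1 / p) := by
  have hp0 : 0 < p := by linarith
  induction N with
  | zero => simp [hp0]
  | succ N ih =>
    simp only [Finset.sum_range_succ]
    refine le_trans ?_ (add_le_add_left ih _)
    exact ENNReal.lintegral_Lp_add_le
      (Finset.measurable_fun_sum _ fun k _ => hF k).aemeasurable (hF N).aemeasurable hp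

/-- Minkowski's inequality for series of nonnegative functions. -/
lemma lintegral_rpow_tsum_le {α : Type*} [MeasurableSpace α] {μ : Measure α} {p : ℝ}
    (hp : 1 ≤ p) {F : ℕ → α → ℝ≥0∞} (hF : ∀ k, Measurable (F k)) :
    (∫⁻ x, (∑' k, F k x) ^ p ∂μ) ^ (1 / p) ≤ ∑' k, (∫⁻ x, F k x ^ p ∂μ) ^ (1 / p) := by
  have hp0 : 0 ≤ p := by linarith
  have hlim : Tendsto (fun N => ∫⁻ x, (∑ k ∈ Finset.range N, F k x) ^ p ∂μ) atTop
      (𝓝 (∫⁻ x, (∑' k, F k x) ^ p ∂μ)) := by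
    refine lintegral_tendsto_of_tendsto_of_monotone
      (fun N => ((Finset.measurable_fun_sum _ fun k _ => hF k).pow_const p).aemeasurable)
      (.of_forall fun x M N hMN => ?_) (.of_forall fun x => ?_)
    · exact ENNReal.rpow_le_rpow (Finset.sum_le_sum_of_subset (Finset.range_mono hMN)) hp0
    · exact (ENNReal.continuous_rpow_const.tendsto _).comp
        ENNReal.summable.hasSum.tendsto_sum_nat
  refine le_of_tendsto' ((ENNReal.continuous_rpow_const.tendsto _).comp hlim) fun N => ?_
  exact (lintegral_rpow_sum_le hp hF N).trans (ENNReal.sum_le_tsum _)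

/-- The geometric series of ratio `2 ^ (-s)` is at most `2 / s`. -/
lemma tsum_two_rpow_neg_pow_le {s : ℝ} (hs0 : 0 < s) (hs1 : s ≤ 1) :
    ∑' k : ℕ, ENNReal.ofReal ((2 : ℝ) ^ (-s)) ^ k ≤ ENNReal.ofReal (2 / s) := by
  have hr : (2 : ℝ) ^ (-s) ≤ 1 - s / 2 := by
    have := rpow_one_add_le_one_add_mul_self (s := -(1 / 2)) (by norm_num) hs0.le hs1
    rw [Real.rpow_neg (by norm_num), ← Real.inv_rpow (by norm_num)]
    norm_num at this ⊢
    linarith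
  rw [ENNReal.tsum_geometric, ← ENNReal.ofReal_one, ← ENNReal.ofReal_sub _ (by positivity),
    ← ENNReal.ofReal_inv_of_pos (by linarith)]
  refine ENNReal.ofReal_le_ofReal ?_
  rw [← inv_div s 2]
  exact inv_anti₀ (by positivity) (by linarith)

namespace MemY

open DyadicCube

variable {n : ℕ} {q β : ℝ} {Y : (Fin n → ℝ) → ℝ → ℝ≥0∞}

lemma one_le (hM : MemY q β Y) (hY : IsCubeFunctional Y) : 1 ≤ ENNReal.ofReal β := by
  have h1 : (0 : ℝ) < 1 := one_pos
  obtain ⟨hpos, hlt⟩ := hY 0 1 h1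
  have := hM 0 1 h1 1 le_rfl {((0 : Fin n → ℝ), (1 : ℝ))} (by simp) (by simp) (by simp)
  simp only [tsum_singleton ((0 : Fin n → ℝ), (1 : ℝ)) fun p => Y p.1 p.2, Real.one_rpow,
    ENNReal.ofReal_one, mul_one] at this
  exact (ENNReal.mul_le_mul_iff_left hpos.ne' hlt.ne).1 (by rwa [one_mul])

lemma tsum_stopping_le (hM : MemY q β Y) (a : Fin n → ℝ) {h : ℝ} (hh : 0 < h)
    {E : ℕ × (Fin n → ℤ) → ℝ≥0∞} {t : ℝ≥0∞} {L : ℝ} (hL : 1 ≤ L)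
    (hvol : ∑' P : stopping E t, volume (closedCell a h P) ≤
      volume (Cube a h) / ENNReal.ofReal L) :
    ∑' P : stopping E t, Y (corner a h P) (side h P.1.1) ≤
      ENNReal.ofReal β * Y a h * ENNReal.ofReal (L ^ (-1 / q)) := by
  let φ : ℕ × (Fin n → ℤ) → (Fin n → ℝ) × ℝ := fun P => (corner a h P, side h P.1)
  have hφ : Function.Injective φ := corner_side_injective a hh
  have := hM a h hh L hL (φ '' stopping E t) ?_ ?_ ?_
  · rwa [tsum_image (fun p : (Fin n → ℝ) × ℝ => Y p.1 p.2) hφ.injOn] at this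
  · rintro _ ⟨P, hP, rfl⟩
    exact ⟨side_pos hh _, closedCell_subset_of_mem_stopping hh hP⟩
  · rintro _ ⟨P, hP, rfl⟩ _ ⟨R, hR, rfl⟩ hne
    exact (pairwiseDisjoint_stopping a hh E t hP hR fun H => hne (congrArg φ H)).mono
      (interior_cube_subset _ _) (interior_cube_subset _ _)
  · rwa [tsum_image (fun p : (Fin n → ℝ) × ℝ => volume (Cube p.1 p.2)) hφ.injOn]

/-- The weighted oscillation estimate in terms of any positive bound for the BMO norm. -/
lemma lintegral_rpow_le (hM : MemY q β Y) (hq : 1 < q) (hY : IsCubeFunctional Y)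
    {w f : (Fin n → ℝ) → ℝ} (hw : IsWeight w)
    (hwY : ∀ (a : Fin n → ℝ) (h : ℝ), 0 < h → wInt w a h ≤ Y a h)
    (hf : LocallyIntegrable f volume) {b : ℝ≥0∞} (hb : bmoNorm f ≤ b) (hb0 : b ≠ 0)
    (hbt : b ≠ ⊤) (a : Fin n → ℝ) {h : ℝ} (hh : 0 < h) {p : ℝ} (hp : 1 ≤ p) :
    ((∫⁻ x in Cube a h, ENNReal.ofReal (|f x - cubeAvg a h f| ^ p * w x)) / Y a h) ^ (1 / p) ≤
      (2 ^ n + 2) * b * (ENNReal.ofReal β * ENNReal.ofReal (2 * (p * q))) := by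
  have hp0 : 0 < p := by linarith
  have hq0 : 0 < q := by linarith
  set K : ℝ≥0∞ := (2 ^ n + 2) * b with hK
  have hK0 : K ≠ 0 := by simp [hK, hb0]
  have hKt : K ≠ ⊤ := by finiteness
  set c := cubeAvg a h f with hc
  let S : ℕ → Set (ℕ × (Fin n → ℤ)) := fun k => stopping (meanDist f c a h) (k * K)
  let Ω : ℕ → Set (Fin n → ℝ) := fun k => ⋃ P ∈ S k, cell a h P
  have hΩ : ∀ k, MeasurableSet (Ω k) := fun k =>
    MeasurableSet.biUnion (S k).to_countable fun P _ => measurableSet_cell a h P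
  let F : ℕ → (Fin n → ℝ) → ℝ≥0∞ := fun k => (Ω k).indicator 1
  have hF : ∀ k, Measurable (F k) := fun k => measurable_one.indicator (hΩ k)
  have hwm : AEMeasurable (fun x => ENNReal.ofReal (w x))
      ((volume : Measure (Fin n → ℝ)).restrict (halfCube a h)) :=
    hw.2.aestronglyMeasurable.aemeasurable.ennreal_ofReal.restrict
  set μ := ((volume : Measure (Fin n → ℝ)).restrict (halfCube a h)).withDensity
    fun x => ENNReal.ofReal (w x) with hμ
  have hμΩ : ∀ k, μ (Ω k) ≤ ENNReal.ofReal β * Y a h *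
      ENNReal.ofReal ((2 ^ k : ℝ) ^ (-1 / q)) := by
    intro k
    have hvol := tsum_volume_stopping_le hf hb hb0 hbt a hh k
    refine le_trans ?_ (hM.tsum_stopping_le a hh (one_le_pow₀ one_le_two) (by
      rw [ENNReal.ofReal_pow (by norm_num), ENNReal.ofReal_ofNat]
      exact hvol))
    calc μ (Ω k) = ∫⁻ x in Ω k, ENNReal.ofReal (w x) ∂(volume.restrict (halfCube a h)) :=
          withDensity_apply _ (hΩ k)
      _ ≤ ∫⁻ x in Ω k, ENNReal.ofReal (w x) :=
          lintegral_mono' (Measure.restrict_mono le_rfl Measure.restrict_le_self) le_rfl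
      _ = ∑' P : S k, ∫⁻ x in cell a h P, ENNReal.ofReal (w x) :=
          lintegral_biUnion (S k).to_countable (fun P _ => measurableSet_cell a h P)
            (pairwiseDisjoint_stopping a hh _ _) _
      _ ≤ ∑' P : S k, Y (corner a h P) (side h P.1.1) := by
          refine ENNReal.tsum_le_tsum fun P => ?_
          rw [restrict_cell]
          exact hwY _ _ (side_pos hh _)
  have hFp : ∀ k, (∫⁻ x, F k x ^ p ∂μ) ^ (1 / p) ≤
      (ENNReal.ofReal β * Y a h) ^ (1 / p) *
        ENNReal.ofReal ((2 : ℝ) ^ (-(1 / (p * q)))) ^ k := by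
    intro k
    have h1 : ∫⁻ x, F k x ^ p ∂μ = μ (Ω k) := by
      rw [← lintegral_indicator_one (hΩ k)]
      refine lintegral_congr fun x => ?_
      by_cases hx : x ∈ Ω k <;> simp [F, hx, hp0]
    rw [h1]
    refine (ENNReal.rpow_le_rpow (hμΩ k) (by positivity)).trans_eq ?_
    rw [ENNReal.mul_rpow_of_nonneg _ _ (by positivity),
      ENNReal.ofReal_rpow_of_nonneg (by positivity) (by positivity),
      ← ENNReal.ofReal_pow (by positivity), ← Real.rpow_natCast, ← Real.rpow_natCast,
      ← Real.rpow_mul (by norm_num), ← Real.rpow_mul (by norm_num),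
      ← Real.rpow_mul (by norm_num)]
    congr 3
    field_simp
  have hsum : (∫⁻ x, (∑' k, F k x) ^ p ∂μ) ^ (1 / p) ≤
      (ENNReal.ofReal β * Y a h) ^ (1 / p) * ENNReal.ofReal (2 * (p * q)) := by
    refine (lintegral_rpow_tsum_le hp hF).trans ((ENNReal.tsum_le_tsum hFp).trans ?_)
    rw [ENNReal.tsum_mul_left]
    gcongr
    have hpq : 1 ≤ p * q := one_le_mul_of_one_le_of_one_le hp hq.le
    refine (tsum_two_rpow_neg_pow_le (by positivity)
      ((div_le_one (by positivity)).2 hpq)).trans_eq ?_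
    rw [div_div_eq_mul_div, div_one]
  have hmain : ∫⁻ x in Cube a h, ENNReal.ofReal (|f x - c| ^ p * w x) ≤
      K ^ p * ∫⁻ x, (∑' k, F k x) ^ p ∂μ := by
    rw [hμ, lintegral_withDensity_eq_lintegral_mul₀ hwm
      ((Measurable.tsum hF).pow_const p).aemeasurable, ← restrict_halfCube,
      ← lintegral_const_mul' _ _ (by finiteness)]
    refine lintegral_mono_ae ((ae_restrict_iff' (measurableSet_halfCube a h)).2 ?_)
    filter_upwards [ae_ofReal_abs_sub_le_tsum hf c a hh hK0 hKt] with x hx hxQ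
    rw [ENNReal.ofReal_mul (by positivity), ← ENNReal.ofReal_rpow_of_nonneg (abs_nonneg _) hp0.le,
      Pi.mul_apply, mul_left_comm, mul_comm, ← ENNReal.mul_rpow_of_nonneg _ _ hp0.le]
    gcongr
    exact hx hxQ
  have hβ := hM.one_le hY
  have hinv : 1 / p ≤ 1 := (div_le_one hp0).2 hp
  calc ((∫⁻ x in Cube a h, ENNReal.ofReal (|f x - c| ^ p * w x)) / Y a h) ^ (1 / p)
      ≤ (K ^ p * (∫⁻ x, (∑' k, F k x) ^ p ∂μ) / Y a h) ^ (1 / p) := by gcongr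
    _ = K * (∫⁻ x, (∑' k, F k x) ^ p ∂μ) ^ (1 / p) / Y a h ^ (1 / p) := by
      rw [ENNReal.div_rpow_of_nonneg _ _ (by positivity),
        ENNReal.mul_rpow_of_nonneg _ _ (by positivity), ← ENNReal.rpow_mul,
        mul_one_div_cancel hp0.ne', ENNReal.rpow_one]
    _ ≤ K * (ENNReal.ofReal β ^ (1 / p) * ENNReal.ofReal (2 * (p * q))) := by
      refine ENNReal.div_le_of_le_mul ((mul_le_mul_right hsum K).trans_eq ?_)
      rw [ENNReal.mul_rpow_of_nonneg _ _ (by positivity)]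
      ring
    _ ≤ K * (ENNReal.ofReal β * ENNReal.ofReal (2 * (p * q))) := by
      gcongr
      exact (ENNReal.rpow_le_rpow_of_exponent_le hβ hinv).trans_eq (ENNReal.rpow_one _)

end MemY

/-- if `Y ∈ 𝒴_q` with constant `β_Y` and `w(Q) ≤ Y(Q)` for all cubes, then for
`f ∈ BMO`, every cube `Q` and every `p ≥ 1`,
`((1/Y(Q)) ∫_Q |f - f_Q|^p w)^{1/p} ≤ c p q β_Y ‖f‖_BMO`. -/
theorem stmt2 (n : ℕ) :
    ∃ c : ℝ, 0 < c ∧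
      ∀ (q β : ℝ), 1 < q → 0 ≤ β →
      ∀ (w : (Fin n → ℝ) → ℝ) (Y : (Fin n → ℝ) → ℝ → ℝ≥0∞) (f : (Fin n → ℝ) → ℝ),
        IsWeight w → IsCubeFunctional Y → MemY q β Y →
        (∀ (a : Fin n → ℝ) (h : ℝ), 0 < h → wInt w a h ≤ Y a h) →
        LocallyIntegrable f volume → bmoNorm f < ⊤ →
        ∀ (a : Fin n → ℝ) (h : ℝ), 0 < h → ∀ p : ℝ, 1 ≤ p →
          ((∫⁻ x in Cube a h, ENNReal.ofReal (|f x - cubeAvg a h f| ^ p * w x)) / Y a h) ^ (1 / p)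
            ≤ ENNReal.ofReal (c * p * q * β) * bmoNorm f := by
  refine ⟨2 * (2 ^ n + 2), by positivity, ?_⟩
  intro q β hq hβ w Y f hw hY hM hwY hf hfb a h hh p hp
  set C := 2 * (2 ^ n + 2) * p * q * β with hC
  have hC0 : 0 ≤ C := by positivity
  have hlim : Tendsto (fun ε : ℝ≥0∞ => ENNReal.ofReal C * (bmoNorm f + ε)) (𝓝[>] 0)
      (𝓝 (ENNReal.ofReal C * (bmoNorm f + 0))) :=
    (ENNReal.Tendsto.const_mul (tendsto_const_nhds.add tendsto_id)
      (Or.inr ENNReal.ofReal_ne_top)).mono_left nhdsWithin_le_nhds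
  rw [add_zero] at hlim
  refine ge_of_tendsto hlim ?_
  filter_upwards [Ioo_mem_nhdsGT (zero_lt_one (α := ℝ≥0∞))] with ε hε
  refine (hM.lintegral_rpow_le hq hY hw hwY hf (le_self_add : bmoNorm f ≤ bmoNorm f + ε)
    (by simp [hε.1.ne']) (ENNReal.add_ne_top.2 ⟨hfb.ne, (hε.2.trans ENNReal.one_lt_top).ne⟩)
    a hh hp).trans_eq ?_
  have hpow : (2 ^ n + 2 : ℝ≥0∞) = ENNReal.ofReal (2 ^ n + 2) := by
    rw [ENNReal.ofReal_add (by positivity) (by norm_num), ENNReal.ofReal_pow (by norm_num)]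
    simp
  rw [hpow, mul_right_comm, ← ENNReal.ofReal_mul hβ, ← ENNReal.ofReal_mul (by positivity), hC]
  congr 2
  ring
end
end
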